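/- arXiv:1409.0564 — 2 statements merged into one kernel-verified Lean document; each statement's English description precedes it below -/
import Mathlib

section
/- Let s > 1 and let X be an n×n positive semidefinite complex matrix. Then Tr[X^s] = s · sup over positive semidefinite n×n matrices Z of { Tr[X Z^{1−1/s}] + (1/s − 1) Tr[Z] }. -/
open Matrix
open scoped ComplexOrder

/-- Real power of a matrix, defined via the spectral decomposition when the matrix is
Hermitian (junk value `0` otherwise). For a positive (semi-)definite matrix this is the
usual real power given by the spectral functional calculus (with `0 ^ r = 0`). -/
noncomputable def mpow {n : ℕ} (A : Matrix (Fin n) (Fin n) ℂ) (r : ℝ) :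
    Matrix (Fin n) (Fin n) ℂ :=
  if h : A.IsHermitian then
    (h.eigenvectorUnitary : Matrix (Fin n) (Fin n) ℂ) *
      Matrix.diagonal (fun i => ((h.eigenvalues i ^ r : ℝ) : ℂ)) *
      (star h.eigenvectorUnitary : Matrix (Fin n) (Fin n) ℂ)
  else 0

/-- The spectral power agrees with the continuous functional calculus. -/
lemma mpow_eq_cfc {n : ℕ} {A : Matrix (Fin n) (Fin n) ℂ} (hA : A.IsHermitian) (r : ℝ) :
    mpow A r = cfc (fun x : ℝ => x ^ r) A := by
  rw [hA.cfc_eq, mpow, dif_pos hA, Matrix.IsHermitian.cfc, Unitary.conjStarAlgAut_apply]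
  rfl

lemma posSemidef_mpow {n : ℕ} {A : Matrix (Fin n) (Fin n) ℂ} (hA : A.PosSemidef) (r : ℝ) :
    (mpow A r).PosSemidef := by
  rw [mpow, dif_pos hA.isHermitian]
  refine PosSemidef.mul_mul_conjTranspose_same (PosSemidef.diagonal fun i => ?_) _
  exact Complex.zero_le_real.mpr (Real.rpow_nonneg (hA.eigenvalues_nonneg i) r)

lemma trace_mpow_re {n : ℕ} {A : Matrix (Fin n) (Fin n) ℂ} (hA : A.IsHermitian) (r : ℝ) :
    (mpow A r).trace.re = ∑ i, hA.eigenvalues i ^ r := by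
  rw [mpow, dif_pos hA, trace_mul_cycle, Unitary.coe_star_mul_self, one_mul, trace_diagonal]
  simp

lemma trace_re_eq_sum_eigenvalues {n : ℕ} {A : Matrix (Fin n) (Fin n) ℂ} (hA : A.IsHermitian) :
    A.trace.re = ∑ i, hA.eigenvalues i := by
  rw [hA.trace_eq_sum_eigenvalues]
  simp

lemma mul_mpow_mpow {n : ℕ} {X : Matrix (Fin n) (Fin n) ℂ} (hX : X.PosSemidef) {s : ℝ}
    (hs : 1 < s) : X * mpow (mpow X s) (1 - 1 / s) = mpow X s := by
  have hsp (f : ℝ → ℝ) : ContinuousOn f (spectrum ℝ X) := X.finite_real_spectrum.continuousOn f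
  have hH : IsSelfAdjoint X := hX.isHermitian
  rw [mpow_eq_cfc (posSemidef_mpow hX s).isHermitian, mpow_eq_cfc hX.isHermitian,
    ← cfc_comp' _ _ X ((X.finite_real_spectrum.image _).continuousOn _) (hsp _) hH]
  nth_rewrite 1 [← cfc_id' ℝ X hH]
  rw [← cfc_mul _ _ X (hsp _) (hsp _)]
  refine cfc_congr fun x hx => ?_
  rw [hX.isHermitian.spectrum_real_eq_range_eigenvalues] at hx
  obtain ⟨i, rfl⟩ := hx
  have h0 := hX.eigenvalues_nonneg i
  have hs0 : s ≠ 0 := by positivity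
  have he : s * (1 - 1 / s) = s - 1 := by field_simp
  rw [← Real.rpow_mul h0, he]
  nth_rewrite 1 [← Real.rpow_one (hX.isHermitian.eigenvalues i)]
  rw [← Real.rpow_add_of_nonneg h0 zero_le_one (by linarith)]
  congr 1
  ring

/-- The trace of a product of two unitarily diagonalized matrices, in terms of the squared moduli
of the overlaps of the two bases. -/
lemma trace_conj_diagonal_mul_conj_diagonal {n : ℕ} (U V : Matrix (Fin n) (Fin n) ℂ)
    (a b : Fin n → ℝ) :
    ((U * diagonal (fun i => (a i : ℂ)) * star U) *
      (V * diagonal (fun i => (b i : ℂ)) * star V)).trace.re =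
      ∑ i, ∑ j, a i * b j * Complex.normSq ((star U * V) i j) := by
  have h : ((U * diagonal (fun i => (a i : ℂ)) * star U) *
      (V * diagonal (fun i => (b i : ℂ)) * star V)).trace =
      (diagonal (fun i => (a i : ℂ)) * (star U * V) *
        (diagonal (fun i => (b i : ℂ)) * star (star U * V))).trace := by
    rw [star_mul, star_star]
    simp only [mul_assoc]
    rw [trace_mul_comm U]
    simp only [mul_assoc]
  rw [h]
  generalize star U * V = W
  simp only [trace, diag_apply, Matrix.mul_apply (M := diagonal _ * W), diagonal_mul,
    star_apply, Complex.re_sum]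
  refine Finset.sum_congr rfl fun i _ => Finset.sum_congr rfl fun j _ => ?_
  simp [Complex.normSq_apply]
  ring

lemma sum_normSq_row {n : ℕ} {W : Matrix (Fin n) (Fin n) ℂ} (hW : W * star W = 1) (i : Fin n) :
    ∑ j, Complex.normSq (W i j) = 1 := by
  have h := congrFun (congrFun hW i) i
  simp only [Matrix.mul_apply, star_apply, one_apply_eq, Complex.star_def,
    Complex.mul_conj] at h
  exact_mod_cast h

lemma sum_normSq_col {n : ℕ} {W : Matrix (Fin n) (Fin n) ℂ} (hW : star W * W = 1) (j : Fin n) :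
    ∑ i, Complex.normSq (W i j) = 1 := by
  have h := congrFun (congrFun hW j) j
  simp only [Matrix.mul_apply, star_apply, one_apply_eq, Complex.star_def,
    ← Complex.normSq_eq_conj_mul_self] at h
  exact_mod_cast h

/-- Young's inequality for traces. -/
lemma trace_mul_mpow_le {n : ℕ} {X Z : Matrix (Fin n) (Fin n) ℂ} (hX : X.PosSemidef)
    (hZ : Z.PosSemidef) {s : ℝ} (hs : 1 < s) :
    (X * mpow Z (1 - 1 / s)).trace.re ≤
      1 / s * (mpow X s).trace.re + (1 - 1 / s) * Z.trace.re := by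
  have hs0 : 0 < s := by linarith
  have hs1 : 1 / s ≤ 1 := (div_le_one hs0).mpr hs.le
  set U := hX.isHermitian.eigenvectorUnitary
  set V := hZ.isHermitian.eigenvectorUnitary
  set a := hX.isHermitian.eigenvalues
  set b := hZ.isHermitian.eigenvalues
  have hXU : X = (U : Matrix (Fin n) (Fin n) ℂ) * diagonal (fun i => (a i : ℂ)) *
      star (U : Matrix (Fin n) (Fin n) ℂ) := by
    conv_lhs => rw [hX.isHermitian.spectral_theorem, Unitary.conjStarAlgAut_apply]
    rfl
  have hZV : mpow Z (1 - 1 / s) = (V : Matrix (Fin n) (Fin n) ℂ) *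
      diagonal (fun i => ((b i ^ (1 - 1 / s) : ℝ) : ℂ)) *
      star (V : Matrix (Fin n) (Fin n) ℂ) := by
    rw [mpow, dif_pos hZ.isHermitian]
  have htr : (X * mpow Z (1 - 1 / s)).trace.re = ∑ i, ∑ j, a i * b j ^ (1 - 1 / s) *
      Complex.normSq ((star (U : Matrix (Fin n) (Fin n) ℂ) * V) i j) := by
    rw [hZV]
    conv_lhs => rw [hXU]
    exact trace_conj_diagonal_mul_conj_diagonal _ _ _ _
  set W := star (U : Matrix (Fin n) (Fin n) ℂ) * V
  have hrow : W * star W = 1 := Unitary.coe_mul_star_self (star U * V)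
  have hcol : star W * W = 1 := Unitary.coe_star_mul_self (star U * V)
  calc (X * mpow Z (1 - 1 / s)).trace.re
      = ∑ i, ∑ j, a i * b j ^ (1 - 1 / s) * Complex.normSq (W i j) := htr
    _ ≤ ∑ i, ∑ j, (1 / s * a i ^ s + (1 - 1 / s) * b j) * Complex.normSq (W i j) := by
        refine Finset.sum_le_sum fun i _ => Finset.sum_le_sum fun j _ => ?_
        refine mul_le_mul_of_nonneg_right ?_ (Complex.normSq_nonneg _)
        have ha : 0 ≤ a i := hX.eigenvalues_nonneg i
        have h := Real.geom_mean_le_arith_mean2_weighted (one_div_nonneg.mpr hs0.le)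
          (sub_nonneg.mpr hs1) (Real.rpow_nonneg ha s) (hZ.eigenvalues_nonneg j) (by ring)
        rwa [← Real.rpow_mul ha, mul_one_div_cancel hs0.ne', Real.rpow_one] at h
    _ = 1 / s * ∑ i, a i ^ s * ∑ j, Complex.normSq (W i j) +
          (1 - 1 / s) * ∑ j, b j * ∑ i, Complex.normSq (W i j) := by
        simp only [add_mul, Finset.sum_add_distrib, Finset.mul_sum, mul_assoc]
        rw [Finset.sum_comm (f := fun i j => (1 - 1 / s) * (b j * Complex.normSq (W i j)))]
    _ = 1 / s * (mpow X s).trace.re + (1 - 1 / s) * Z.trace.re := by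
        simp only [sum_normSq_row hrow, sum_normSq_col hcol, mul_one]
        rw [trace_mpow_re hX.isHermitian, trace_re_eq_sum_eigenvalues hZ.isHermitian]

/-- The variational formula
`Tr[X^s] = s · sup_{Z ≥ 0} { Tr[X Z^{1−1/s}] + (1/s − 1) Tr[Z] }` for `s > 1`. -/
theorem trace_power_sup_formula (n : ℕ) (s : ℝ) (hs : 1 < s)
    (X : Matrix (Fin n) (Fin n) ℂ) (hX : X.PosSemidef) :
    (Matrix.trace (mpow X s)).re =
      s * sSup {v : ℝ | ∃ Z : Matrix (Fin n) (Fin n) ℂ, Z.PosSemidef ∧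
        v = (Matrix.trace (X * mpow Z (1 - 1 / s))).re +
          (1 / s - 1) * (Matrix.trace Z).re} := by
  have hs0 : s ≠ 0 := by positivity
  have hmax : IsGreatest {v : ℝ | ∃ Z : Matrix (Fin n) (Fin n) ℂ, Z.PosSemidef ∧
      v = (Matrix.trace (X * mpow Z (1 - 1 / s))).re + (1 / s - 1) * (Matrix.trace Z).re}
      (1 / s * (mpow X s).trace.re) := by
    constructor
    · refine ⟨mpow X s, posSemidef_mpow hX s, ?_⟩
      rw [mul_mpow_mpow hX hs]
      ring
    · rintro v ⟨Z, hZ, rfl⟩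
      linarith [trace_mul_mpow_le hX hZ hs]
  rw [hmax.csSup_eq, ← mul_assoc, mul_one_div_cancel hs0, one_mul]
end

section
/- Let 0 < s < 1 and let X be an n×n positive semidefinite complex matrix. Then Tr[X^s] = s · inf over positive definite n×n matrices Z of { Tr[X Z^{1−1/s}] + (1/s − 1) Tr[Z] }. -/
open Matrix
open scoped ComplexOrder

namespace Matrix.IsHermitian

variable {n : ℕ} {A B : Matrix (Fin n) (Fin n) ℂ}

lemma mpow_eq_cfc (hA : A.IsHermitian) (r : ℝ) : mpow A r = cfc (fun x : ℝ => x ^ r) A := by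
  rw [hA.cfc_eq, IsHermitian.cfc, Unitary.conjStarAlgAut_apply, mpow, dif_pos hA]
  rfl

lemma cfc_eq_mul_diagonal_mul (hA : A.IsHermitian) (f : ℝ → ℝ) :
    cfc f A = (hA.eigenvectorUnitary : Matrix (Fin n) (Fin n) ℂ) *
      diagonal (fun i => (f (hA.eigenvalues i) : ℂ)) *
      star (hA.eigenvectorUnitary : Matrix (Fin n) (Fin n) ℂ) := by
  rw [hA.cfc_eq, IsHermitian.cfc, Unitary.conjStarAlgAut_apply]
  rfl

lemma trace_cfc_re (hA : A.IsHermitian) (f : ℝ → ℝ) :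
    (trace (cfc f A)).re = ∑ i, f (hA.eigenvalues i) := by
  rw [hA.cfc_eq_mul_diagonal_mul, trace_mul_cycle, Unitary.coe_star_mul_self, one_mul,
    trace_diagonal]
  simp

/-- The trace of a product of functions of two Hermitian matrices, in terms of the overlaps of
their eigenvectors. -/
lemma trace_cfc_mul_cfc_re (hA : A.IsHermitian) (hB : B.IsHermitian) (f g : ℝ → ℝ) :
    (trace (cfc f A * cfc g B)).re =
      ∑ i, ∑ j, f (hA.eigenvalues i) * g (hB.eigenvalues j) *
        Complex.normSq ((star (hA.eigenvectorUnitary : Matrix (Fin n) (Fin n) ℂ) *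
          (hB.eigenvectorUnitary : Matrix (Fin n) (Fin n) ℂ)) i j) := by
  rw [hA.cfc_eq_mul_diagonal_mul, hB.cfc_eq_mul_diagonal_mul]
  set U := (hA.eigenvectorUnitary : Matrix (Fin n) (Fin n) ℂ)
  set V := (hB.eigenvectorUnitary : Matrix (Fin n) (Fin n) ℂ)
  set D := diagonal (fun i => (f (hA.eigenvalues i) : ℂ))
  set E := diagonal (fun i => (g (hB.eigenvalues i) : ℂ)) with hE
  have h : trace (U * D * star U * (V * E * star V)) =
      trace (D * ((star U * V) * E * star (star U * V))) := by
    rw [star_mul, star_star, mul_assoc, mul_assoc, trace_mul_comm]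
    simp only [mul_assoc]
  rw [h]
  simp only [trace, diag_apply, Complex.re_sum, D, diagonal_mul]
  refine Finset.sum_congr rfl fun i _ => ?_
  rw [mul_apply, Finset.mul_sum, Complex.re_sum]
  refine Finset.sum_congr rfl fun j _ => ?_
  rw [hE, mul_diagonal, star_apply]
  have := Complex.mul_conj ((star U * V) i j)
  rw [show (f (hA.eigenvalues i) : ℂ) * ((star U * V) i j * (g (hB.eigenvalues j) : ℂ) *
      star ((star U * V) i j)) = ((f (hA.eigenvalues i) * g (hB.eigenvalues j) *
        Complex.normSq ((star U * V) i j) : ℝ) : ℂ) by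
    push_cast
    rw [← this, starRingEnd_apply]
    ring, Complex.ofReal_re]

/-- A trace inequality between functions of two Hermitian matrices follows from the scalar
inequality on their spectra. -/
lemma trace_cfc_le (hA : A.IsHermitian) (hB : B.IsHermitian) {f g h k : ℝ → ℝ}
    (H : ∀ i j, f (hA.eigenvalues i) ≤
      g (hA.eigenvalues i) * h (hB.eigenvalues j) + k (hB.eigenvalues j)) :
    (trace (cfc f A)).re ≤ (trace (cfc g A * cfc h B)).re + (trace (cfc k B)).re := by
  have h₁ := hA.trace_cfc_mul_cfc_re hB f 1
  have h₂ := hA.trace_cfc_mul_cfc_re hB 1 k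
  rw [cfc_one ℝ B hB.isSelfAdjoint, mul_one] at h₁
  rw [cfc_one ℝ A hA.isSelfAdjoint, one_mul] at h₂
  rw [h₁, h₂, hA.trace_cfc_mul_cfc_re hB g h, ← Finset.sum_add_distrib]
  refine Finset.sum_le_sum fun i _ => ?_
  rw [← Finset.sum_add_distrib]
  refine Finset.sum_le_sum fun j _ => ?_
  rw [← add_mul]
  refine mul_le_mul_of_nonneg_right ?_ (Complex.normSq_nonneg _)
  simpa using H i j

lemma posDef_cfc (hA : A.IsHermitian) {f : ℝ → ℝ} (hf : ∀ i, 0 < f (hA.eigenvalues i)) :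
    (cfc f A).PosDef := by
  rw [hA.cfc_eq_mul_diagonal_mul]
  refine (Unitary.isUnit_coe.posDef_star_right_conjugate_iff).2 ?_
  rw [posDef_diagonal_iff]
  exact fun i => by exact_mod_cast hf i

end Matrix.IsHermitian

/-- The scalar Young inequality behind the variational formula. -/
lemma rpow_le_mul_rpow_add {s x z : ℝ} (hs₁ : 0 < s) (hs₂ : s < 1) (hx : 0 ≤ x) (hz : 0 < z) :
    x ^ s ≤ s * (x * z ^ (1 - 1 / s)) + (1 - s) * z := by
  have h := Real.geom_mean_le_arith_mean2_weighted hs₁.le (sub_nonneg.2 hs₂.le)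
    (mul_nonneg hx (Real.rpow_nonneg hz.le (1 - 1 / s))) hz.le (add_sub_cancel s 1)
  rwa [Real.mul_rpow hx (Real.rpow_nonneg hz.le _), ← Real.rpow_mul hz.le, mul_assoc,
    ← Real.rpow_add hz, show (1 - 1 / s) * s + (1 - s) = 0 by field_simp; ring,
    Real.rpow_zero, mul_one] at h

/-- Every positive definite `Z` gives an upper bound for the trace of `X ^ s`. -/
lemma trace_mpow_le {n : ℕ} {s : ℝ} (hs₁ : 0 < s) (hs₂ : s < 1)
    {X Z : Matrix (Fin n) (Fin n) ℂ} (hX : X.PosSemidef) (hZ : Z.PosDef) :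
    (trace (mpow X s)).re ≤ s * ((trace (X * mpow Z (1 - 1 / s))).re +
      (1 / s - 1) * (trace Z).re) := by
  have hXh := hX.isHermitian
  have hZh := hZ.isHermitian
  have key := hXh.trace_cfc_le hZh (f := fun x => x ^ s) (g := fun x => s * x)
    (h := fun z => z ^ (1 - 1 / s)) (k := fun z => (1 - s) * z) fun i j => by
      simpa only [mul_assoc] using
        rpow_le_mul_rpow_add hs₁ hs₂ (hX.eigenvalues_nonneg i) (hZ.eigenvalues_pos j)
  rw [cfc_const_mul_id s X hXh.isSelfAdjoint,
    cfc_const_mul_id (1 - s) Z hZh.isSelfAdjoint, smul_mul_assoc, trace_smul,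
    trace_smul, Complex.real_smul, Complex.real_smul, Complex.re_ofReal_mul,
    Complex.re_ofReal_mul] at key
  rw [hXh.mpow_eq_cfc, hZh.mpow_eq_cfc]
  refine key.trans_eq ?_
  field_simp

/-- The positive definite matrix `(X + ε) ^ s` is nearly optimal. -/
lemma exists_posDef_le {n : ℕ} {s : ℝ} (hs₁ : 0 < s)
    {X : Matrix (Fin n) (Fin n) ℂ} (hX : X.PosSemidef) {ε : ℝ} (hε : 0 < ε) :
    ∃ Z : Matrix (Fin n) (Fin n) ℂ, Z.PosDef ∧
      s * ((trace (X * mpow Z (1 - 1 / s))).re + (1 / s - 1) * (trace Z).re) ≤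
        ∑ i, (hX.isHermitian.eigenvalues i + ε) ^ s := by
  have hXh := hX.isHermitian
  have hpos : ∀ i, 0 < hXh.eigenvalues i + ε := fun i =>
    add_pos_of_nonneg_of_pos (hX.eigenvalues_nonneg i) hε
  have hfin := X.finite_real_spectrum
  have hZ : (cfc (fun x : ℝ => (x + ε) ^ s) X).PosDef :=
    hXh.posDef_cfc fun i => Real.rpow_pos_of_pos (hpos i) s
  refine ⟨_, hZ, ?_⟩
  have hmul : X * mpow (cfc (fun x : ℝ => (x + ε) ^ s) X) (1 - 1 / s) =
      cfc (fun x : ℝ => x * ((x + ε) ^ s) ^ (1 - 1 / s)) X := by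
    rw [hZ.isHermitian.mpow_eq_cfc, ← cfc_comp' (fun x : ℝ => x ^ (1 - 1 / s))
      (fun x : ℝ => (x + ε) ^ s) X ((hfin.image _).continuousOn _) (hfin.continuousOn _)
        hXh.isSelfAdjoint]
    rw [cfc_mul (fun x : ℝ => x) _ X (hfin.continuousOn _) (hfin.continuousOn _),
      cfc_id' ℝ X hXh.isSelfAdjoint]
  rw [hmul, hXh.trace_cfc_re, hXh.trace_cfc_re, Finset.mul_sum, ← Finset.sum_add_distrib,
    Finset.mul_sum]
  refine Finset.sum_le_sum fun i _ => ?_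
  set y := hXh.eigenvalues i + ε
  have h : hXh.eigenvalues i * (y ^ s) ^ (1 - 1 / s) ≤ y ^ s := by
    calc _ ≤ y * (y ^ s) ^ (1 - 1 / s) :=
          mul_le_mul_of_nonneg_right (by linarith)
            (Real.rpow_nonneg (Real.rpow_nonneg (hpos i).le _) _)
      _ = y ^ s := by
          rw [← Real.rpow_mul (hpos i).le, ← Real.rpow_one_add' (hpos i).le]
          · congr 1
            field_simp
            ring
          · field_simp
            linarith
  calc _ ≤ s * (y ^ s + (1 / s - 1) * y ^ s) := by gcongr
    _ = y ^ s := by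
      field_simp
      ring

/-- The variational formula
`Tr[X^s] = s · inf_{Z > 0} { Tr[X Z^{1−1/s}] + (1/s − 1) Tr[Z] }` for `0 < s < 1`. -/
theorem trace_power_inf_formula (n : ℕ) (s : ℝ) (hs₁ : 0 < s) (hs₂ : s < 1)
    (X : Matrix (Fin n) (Fin n) ℂ) (hX : X.PosSemidef) :
    (Matrix.trace (mpow X s)).re =
      s * sInf {v : ℝ | ∃ Z : Matrix (Fin n) (Fin n) ℂ, Z.PosDef ∧
        v = (Matrix.trace (X * mpow Z (1 - 1 / s))).re +
          (1 / s - 1) * (Matrix.trace Z).re} := by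
  set S := {v : ℝ | ∃ Z : Matrix (Fin n) (Fin n) ℂ, Z.PosDef ∧
        v = (Matrix.trace (X * mpow Z (1 - 1 / s))).re +
          (1 / s - 1) * (Matrix.trace Z).re}
  have hlb : ∀ v ∈ S, (trace (mpow X s)).re / s ≤ v := by
    rintro v ⟨Z, hZ, rfl⟩
    rw [div_le_iff₀' hs₁]
    exact trace_mpow_le hs₁ hs₂ hX hZ
  have hne : S.Nonempty := ⟨_, 1, PosDef.one, rfl⟩
  refine le_antisymm ((div_le_iff₀' hs₁).1 (le_csInf hne hlb)) ?_
  have hlim : Filter.Tendsto (fun ε : ℝ => ∑ i, (hX.isHermitian.eigenvalues i + ε) ^ s)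
      (nhdsWithin 0 (Set.Ioi 0)) (nhds (trace (mpow X s)).re) := by
    rw [hX.isHermitian.mpow_eq_cfc, hX.isHermitian.trace_cfc_re]
    refine tendsto_nhdsWithin_of_tendsto_nhds (tendsto_finsetSum _ fun i _ => ?_)
    have : Continuous fun ε : ℝ => (hX.isHermitian.eigenvalues i + ε) ^ s :=
      (continuous_const.add continuous_id).rpow_const fun _ => Or.inr hs₁.le
    simpa using this.tendsto 0
  refine ge_of_tendsto hlim ?_
  filter_upwards [self_mem_nhdsWithin] with ε hε
  obtain ⟨Z, hZ, hle⟩ := exists_posDef_le hs₁ hX hε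
  refine le_trans ?_ hle
  exact mul_le_mul_of_nonneg_left (csInf_le ⟨_, hlb⟩ ⟨Z, hZ, rfl⟩) hs₁.le
end
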